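/- Let (Ω, π) be a finite probability space, (ω_i)_{i≥1} i.i.d. with law π, ξ : Ω → ℝ, ζ : Ω → ℝ^d, and set ξ_i := ξ(ω_i), ζ_i := ζ(ω_i), ξ̄_l := (1/l) Σ_{i=1}^{l} ξ_i, ζ̄_l := (1/l) Σ_{i=1}^{l} ζ_i, and Ξ_l(x) := E[ ξ₁ | ζ̄_l = x ] for x with P(ζ̄_l = x) > 0 (by exchangeability Ξ_l(x) = E[ξ̄_l | ζ̄_l = x]). Then there exists B < ∞, depending only on the joint law of (ξ, ζ), such that for every l ∈ ℕ, every x with P(ζ̄_l = x) > 0, and every γ ∈ ℝ: E[ exp{ γ √l ( ξ̄_l − Ξ_l(x) ) } | ζ̄_l = x ] ≤ exp{ B γ² }. -/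

import Mathlib

open Finset
open scoped Classical

/-- Product weight of a configuration under the i.i.d. law π. -/
noncomputable def wt {Ω : Type} [Fintype Ω] (π : Ω → ℝ) {l : ℕ}
    (σ : Fin l → Ω) : ℝ := ∏ i, π (σ i)

/-- Plain block average ζ̄_l (vector valued). -/
noncomputable def zAvg {Ω : Type} {d : ℕ} (ζ : Ω → Fin d → ℝ) {l : ℕ}
    (σ : Fin l → Ω) : Fin d → ℝ :=
  fun i => (l : ℝ)⁻¹ * ∑ j : Fin l, ζ (σ j) i

/-- Plain block average ξ̄_l. -/
noncomputable def xAvg {Ω : Type} (ξ : Ω → ℝ) {l : ℕ} (σ : Fin l → Ω) : ℝ :=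
  (l : ℝ)⁻¹ * ∑ j : Fin l, ξ (σ j)

/-- Conditional expectation E[f | ζ̄_l = x] under the i.i.d. law π. -/
noncomputable def condExp {Ω : Type} [Fintype Ω] (π : Ω → ℝ) {d : ℕ}
    (ζ : Ω → Fin d → ℝ) {l : ℕ} (x : Fin d → ℝ) (f : (Fin l → Ω) → ℝ) : ℝ :=
  (∑ σ : Fin l → Ω, if zAvg ζ σ = x then wt π σ * f σ else 0) /
  (∑ σ : Fin l → Ω, if zAvg ζ σ = x then wt π σ else 0)

section CoefficientwiseOrder

variable {V : Type*} [AddCommGroup V]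

/-- The coefficientwise order on a real group algebra. -/
noncomputable instance coeffPartialOrder : PartialOrder (AddMonoidAlgebra ℝ V) :=
  PartialOrder.lift (fun f => f.coeff) AddMonoidAlgebra.coeff_injective

theorem coeff_mul_nonneg {f g : AddMonoidAlgebra ℝ V} (hf : 0 ≤ f) (hg : 0 ≤ g) :
    0 ≤ f * g := by
  intro v
  rw [AddMonoidAlgebra.coeff_mul_apply_left]
  exact Finset.sum_nonneg fun h _ => mul_nonneg (hf h) (hg _)

theorem single_nonneg (v : V) {r : ℝ} (hr : 0 ≤ r) : 0 ≤ AddMonoidAlgebra.single v r := by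
  intro w
  change 0 ≤ (AddMonoidAlgebra.single v r).coeff w
  rw [AddMonoidAlgebra.coeff_single, Finsupp.single_apply]
  split_ifs
  exacts [hr, le_rfl]

instance coeffIsOrderedRing : IsOrderedRing (AddMonoidAlgebra ℝ V) where
  add_le_add_left f g h k v := by
    simpa using h v
  zero_le_one := by
    rw [AddMonoidAlgebra.one_def]
    exact single_nonneg _ zero_le_one
  mul_le_mul_of_nonneg_left f hf g h hgh := by
    have key : 0 ≤ f * (h - g) := coeff_mul_nonneg hf fun v => by simpa using hgh v
    intro v
    simpa [mul_sub] using key v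
  mul_le_mul_of_nonneg_right f hf g h hgh := by
    have key : 0 ≤ (h - g) * f := coeff_mul_nonneg (fun v => by simpa using hgh v) hf
    intro v
    simpa [sub_mul] using key v

/-- The involution `v ↦ -v` of a group algebra. -/
noncomputable def coeffReflect : AddMonoidAlgebra ℝ V ≃+* AddMonoidAlgebra ℝ V :=
  AddMonoidAlgebra.mapDomainRingEquiv ℝ (AddEquiv.neg V)

theorem coeff_coeffReflect (f : AddMonoidAlgebra ℝ V) (v : V) :
    (coeffReflect f).coeff v = f.coeff (-v) := by
  simp [coeffReflect]

theorem coeff_mul_self_le (f : AddMonoidAlgebra ℝ V) (v : V) :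
    (f * f).coeff v ≤ (f * coeffReflect f).coeff 0 := by
  rw [AddMonoidAlgebra.coeff_mul_apply_left, AddMonoidAlgebra.coeff_mul_apply_left]
  simp only [coeff_coeffReflect, Finsupp.sum, add_zero, neg_neg]
  set S := f.coeff.support
  have h1 : ∑ u ∈ S, f.coeff (-u + v) ^ 2 ≤ ∑ u ∈ S, f.coeff u ^ 2 := by
    have hinj : Function.Injective fun u : V => -u + v := fun a b h => by simpa using h
    rw [← Finset.sum_image (f := fun u => f.coeff u ^ 2) (g := fun u => -u + v) (s := S)
      (fun a _ b _ h => hinj h)]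
    refine (Finset.sum_le_sum_of_subset_of_nonneg
      (Finset.subset_union_left (s₂ := S)) fun _ _ _ => sq_nonneg _).trans_eq ?_
    refine (Finset.sum_subset Finset.subset_union_right fun u _ hu => ?_).symm
    simp [Finsupp.notMem_support_iff.mp hu]
  have h2 : ∑ u ∈ S, f.coeff u * f.coeff (-u + v) ≤
      ∑ u ∈ S, (f.coeff u ^ 2 / 2 + f.coeff (-u + v) ^ 2 / 2) :=
    Finset.sum_le_sum fun u _ => by nlinarith [sq_nonneg (f.coeff u - f.coeff (-u + v))]
  rw [Finset.sum_add_distrib, ← Finset.sum_div, ← Finset.sum_div] at h2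
  have h3 : ∑ u ∈ S, f.coeff u * f.coeff u = ∑ u ∈ S, f.coeff u ^ 2 :=
    Finset.sum_congr rfl fun u _ => by ring
  linarith

/-- The sum of the coefficients, as a ring homomorphism. -/
noncomputable def coeffSum : AddMonoidAlgebra ℝ V →ₐ[ℝ] ℝ :=
  AddMonoidAlgebra.lift ℝ ℝ V 1

theorem coeffSum_single (v : V) (r : ℝ) : coeffSum (AddMonoidAlgebra.single v r) = r := by
  simp [coeffSum]

theorem coeffSum_eq (f : AddMonoidAlgebra ℝ V) : coeffSum f = f.coeff.sum fun _ r => r := by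
  simp [coeffSum, AddMonoidAlgebra.lift_apply]

theorem coeff_mul_le_of_coeff_le {f g : AddMonoidAlgebra ℝ V} {M : ℝ} (hf : 0 ≤ f)
    (hg : ∀ v, g.coeff v ≤ M) (v : V) : (f * g).coeff v ≤ coeffSum f * M := by
  rw [AddMonoidAlgebra.coeff_mul_apply_left, coeffSum_eq, Finsupp.sum, Finsupp.sum,
    Finset.sum_mul]
  exact Finset.sum_le_sum fun u _ => mul_le_mul_of_nonneg_left (hg _) (hf u)

theorem coeff_mul_coeff_le {f g : AddMonoidAlgebra ℝ V} (hf : 0 ≤ f) (hg : 0 ≤ g) :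
    f.coeff 0 * g.coeff 0 ≤ (f * g).coeff 0 := by
  rw [AddMonoidAlgebra.coeff_mul_apply_left, Finsupp.sum]
  by_cases h : (0 : V) ∈ f.coeff.support
  · refine le_trans (le_of_eq ?_) (Finset.single_le_sum
      (fun u _ => mul_nonneg (hf u) (hg (-u + 0))) h)
    simp
  · rw [Finsupp.notMem_support_iff.mp h, zero_mul]
    exact Finset.sum_nonneg fun u _ => mul_nonneg (hf u) (hg _)

end CoefficientwiseOrder

section Coin

variable {V : Type*} [AddCommGroup V]

/-- Generating function of a step `±v`, exponentially tilted by `s`. -/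
noncomputable def coin (v : V) (s : ℝ) : AddMonoidAlgebra ℝ V :=
  AddMonoidAlgebra.single v (Real.exp s) + AddMonoidAlgebra.single (-v) (Real.exp (-s))

theorem coin_nonneg (v : V) (s : ℝ) : 0 ≤ coin v s :=
  add_nonneg (single_nonneg _ (Real.exp_pos _).le) (single_nonneg _ (Real.exp_pos _).le)

theorem coeffSum_coin (v : V) (s : ℝ) : coeffSum (coin v s) = 2 * Real.cosh s := by
  rw [coin, map_add, coeffSum_single, coeffSum_single, Real.cosh_eq]
  ring

theorem coeffReflect_coin (v : V) (s : ℝ) : coeffReflect (coin v s) = coin v (-s) := by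
  rw [coin, coin, map_add, coeffReflect, AddMonoidAlgebra.mapDomainRingEquiv_single,
    AddMonoidAlgebra.mapDomainRingEquiv_single, neg_neg, add_comm]
  simp

theorem single_le_single (v : V) {r s : ℝ} (h : r ≤ s) :
    AddMonoidAlgebra.single v r ≤ AddMonoidAlgebra.single v s := by
  rw [← sub_nonneg, ← AddMonoidAlgebra.single_sub]
  exact single_nonneg _ (sub_nonneg.mpr h)

theorem coin_le_smul (v : V) (s : ℝ) : coin v s ≤ Real.exp |s| • coin v 0 := by
  simp only [coin, smul_add, AddMonoidAlgebra.smul_single, neg_zero, Real.exp_zero,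
    smul_eq_mul, mul_one]
  exact add_le_add (single_le_single _ (Real.exp_le_exp.mpr (le_abs_self s)))
    (single_le_single _ (Real.exp_le_exp.mpr (neg_le_abs s)))

theorem coin_mul_coin_neg_le (v : V) (s : ℝ) :
    coin v s * coin v (-s) ≤ Real.cosh (2 * s) • (coin v 0 * coin v 0) := by
  have e1 : coin v s * coin v (-s) = AddMonoidAlgebra.single (v + v) 1 +
      AddMonoidAlgebra.single (-v + -v) 1 + AddMonoidAlgebra.single 0 (2 * Real.cosh (2 * s)) := by
    simp only [coin, mul_add, add_mul, AddMonoidAlgebra.single_mul_single, neg_neg, ← Real.exp_add,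
      add_neg_cancel, neg_add_cancel, Real.exp_zero, Real.cosh_eq]
    rw [show 2 * ((Real.exp (2 * s) + Real.exp (-(2 * s))) / 2) =
      Real.exp (s + s) + Real.exp (-s + -s) by ring_nf, AddMonoidAlgebra.single_add]
    abel
  have e2 : Real.cosh (2 * s) • (coin v 0 * coin v 0) =
      AddMonoidAlgebra.single (v + v) (Real.cosh (2 * s)) +
      AddMonoidAlgebra.single (-v + -v) (Real.cosh (2 * s)) +
      AddMonoidAlgebra.single 0 (2 * Real.cosh (2 * s)) := by
    simp only [coin, mul_add, add_mul, AddMonoidAlgebra.single_mul_single, add_neg_cancel,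
      neg_add_cancel, neg_zero, Real.exp_zero, mul_one, two_mul, smul_add,
      AddMonoidAlgebra.smul_single, smul_eq_mul, AddMonoidAlgebra.single_add]
    abel
  rw [e1, e2]
  gcongr <;> exact single_le_single _ (Real.one_le_cosh _)

end Coin

section CoinProduct

variable {V K : Type*} [AddCommGroup V] [Fintype K]

/-- Generating function of a walk with `N k` steps `±a k`, tilted by `s k`. -/
noncomputable def coinProd (a : K → V) (s : K → ℝ) (N : K → ℕ) : AddMonoidAlgebra ℝ V :=
  ∏ k, coin (a k) (s k) ^ N k

variable (a : K → V) (s : K → ℝ)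

theorem coinProd_nonneg (N : K → ℕ) : 0 ≤ coinProd a s N :=
  Finset.prod_nonneg fun _ _ => pow_nonneg (coin_nonneg _ _) _

theorem coinProd_add (M N : K → ℕ) :
    coinProd a s (M + N) = coinProd a s M * coinProd a s N := by
  simp [coinProd, pow_add, Finset.prod_mul_distrib]

theorem coinProd_le_smul (N : K → ℕ) :
    coinProd a s N ≤ (∏ k, Real.exp |s k| ^ N k) • coinProd a 0 N := by
  rw [coinProd, coinProd, ← Finset.prod_smul]
  refine Finset.prod_le_prod (fun _ _ => pow_nonneg (coin_nonneg _ _) _) fun _ _ => ?_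
  rw [← smul_pow]
  exact pow_le_pow_left₀ (coin_nonneg _ _) (coin_le_smul _ _) _

theorem coeffReflect_coinProd (N : K → ℕ) :
    coeffReflect (coinProd a s N) = coinProd a (-s) N := by
  simp [coinProd, coeffReflect_coin]

theorem coinProd_mul_neg_le (N : K → ℕ) :
    coinProd a s N * coinProd a (-s) N ≤
      (∏ k, Real.cosh (2 * s k) ^ N k) • (coinProd a 0 N * coinProd a 0 N) := by
  simp only [coinProd]
  rw [← Finset.prod_mul_distrib, ← Finset.prod_mul_distrib, ← Finset.prod_smul]
  refine Finset.prod_le_prod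
    (fun k _ => mul_nonneg (pow_nonneg (coin_nonneg _ _) _) (pow_nonneg (coin_nonneg _ _) _))
    fun k _ => ?_
  rw [← mul_pow, ← mul_pow, ← smul_pow]
  exact pow_le_pow_left₀ (mul_nonneg (coin_nonneg _ _) (coin_nonneg _ _))
    (coin_mul_coin_neg_le _ _) _

theorem coeffSum_coinProd (N : K → ℕ) :
    coeffSum (coinProd a s N) = ∏ k, (2 * Real.cosh (s k)) ^ N k := by
  simp [coinProd, coeffSum_coin]

theorem coeff_coinProd_mul_self_le (N : K → ℕ) (v : V) :
    (coinProd a s N * coinProd a s N).coeff v ≤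
      (∏ k, Real.cosh (2 * s k) ^ N k) * (coinProd a 0 N * coinProd a 0 N).coeff 0 := by
  refine (coeff_mul_self_le _ v).trans ?_
  rw [coeffReflect_coinProd]
  simpa using coinProd_mul_neg_le a s N 0

/-- Splitting off a residual walk `r` with reachable origin leaves even step numbers. -/
theorem coeff_coinProd_le_of_eq_add (r m : K → ℕ) (hr : 0 < (coinProd a 0 r).coeff 0) :
    (coinProd a s (r + (m + m))).coeff 0 ≤
      (∏ k, (2 * Real.cosh (s k)) ^ r k) / (coinProd a 0 r).coeff 0 *
        (∏ k, Real.cosh (2 * s k) ^ m k) * (coinProd a 0 (r + (m + m))).coeff 0 := by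
  have h1 := coeff_mul_le_of_coeff_le (coinProd_nonneg a s r) (coeff_coinProd_mul_self_le a s m) 0
  have h2 := coeff_mul_coeff_le (coinProd_nonneg a 0 r)
    (mul_nonneg (coinProd_nonneg a 0 m) (coinProd_nonneg a 0 m))
  rw [coeffSum_coinProd] at h1
  rw [coinProd_add, coinProd_add, coinProd_add a 0, coinProd_add a 0]
  refine h1.trans ?_
  have hA : 0 ≤ ∏ k, (2 * Real.cosh (s k)) ^ r k :=
    Finset.prod_nonneg fun k _ => pow_nonneg (by positivity) _
  have hB : 0 ≤ ∏ k, Real.cosh (2 * s k) ^ m k :=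
    Finset.prod_nonneg fun k _ => pow_nonneg (by positivity) _
  rw [mul_comm ((coinProd a 0 r).coeff 0), ← le_div_iff₀ hr] at h2
  calc _ ≤ (∏ k, (2 * Real.cosh (s k)) ^ r k) * ((∏ k, Real.cosh (2 * s k) ^ m k) *
        ((coinProd a 0 r * (coinProd a 0 m * coinProd a 0 m)).coeff 0 /
          (coinProd a 0 r).coeff 0)) := by gcongr
    _ = _ := by ring

theorem prod_cosh_pow_le (N : K → ℕ) :
    ∏ k, Real.cosh (s k) ^ N k ≤ Real.exp (∑ k, N k * s k ^ 2 / 2) := by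
  rw [Real.exp_sum]
  refine Finset.prod_le_prod (fun _ _ => pow_nonneg (Real.cosh_pos _).le _) fun _ _ => ?_
  rw [mul_div_assoc, Real.exp_nat_mul]
  exact pow_le_pow_left₀ (Real.cosh_pos _).le (Real.cosh_le_exp_half_sq _) _

/-- Every set of multi-indices contains, up to even increments, finitely many generators. -/
theorem exists_bound_of_even_increments (S : Set (K → ℕ)) (c : (K → ℕ) → ℝ) :
    ∃ C : ℝ, ∀ N ∈ S, ∃ r ∈ S, ∃ m : K → ℕ, N = r + (m + m) ∧ c r ≤ C := by
  let P (p : K → ℕ) (N : K → ℕ) : Prop := N ∈ S ∧ ∀ k, N k % 2 = p k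
  have hfin (p : K → ℕ) : {r | Minimal (P p) r}.Finite :=
    WellQuasiOrderedLE.finite_of_isAntichain (setOfPred_minimal_antichain _)
  have hpar : (⋃ p ∈ Set.Iic (1 : K → ℕ), {r | Minimal (P p) r}).Finite :=
    (Set.finite_Iic _).biUnion fun p _ => hfin p
  obtain ⟨C, hC⟩ := (hpar.image c).bddAbove
  refine ⟨C, fun N hN => ?_⟩
  obtain ⟨r, hrN, hr⟩ := exists_minimal_le_of_wellFoundedLT 
    (P fun k => N k % 2) N ⟨hN, fun _ => rfl⟩
  refine ⟨r, hr.prop.1, fun k => (N k - r k) / 2, ?_, hC ⟨r, ?_, rfl⟩⟩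
  · funext k
    have h1 : r k % 2 = N k % 2 := hr.prop.2 k
    have h2 : r k ≤ N k := hrN k
    simp only [Pi.add_apply]
    omega
  · refine Set.mem_biUnion (x := fun k => N k % 2) (fun k => ?_) hr
    simp only [Pi.one_apply]
    omega

theorem exists_coeff_coinProd_le (δ : K → ℝ) :
    ∃ C : ℝ, ∀ (N : K → ℕ) (t : ℝ), (coinProd a (t • δ) N).coeff 0 ≤
      C * Real.exp (t ^ 2 * (∑ k, δ k ^ 2) * ∑ k, (N k : ℝ)) * (coinProd a 0 N).coeff 0 := by
  obtain ⟨C, hC⟩ := exists_bound_of_even_increments {N : K → ℕ | 0 < (coinProd a 0 N).coeff 0}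
    fun r => (∏ k, (2 : ℝ) ^ r k) / (coinProd a 0 r).coeff 0
  refine ⟨C, fun N t => ?_⟩
  rcases (coinProd_nonneg a 0 N 0 : (0 : ℝ) ≤ (coinProd a 0 N).coeff 0).eq_or_lt with h0 | hpos
  · have h := coinProd_le_smul a (t • δ) N 0
    simp only [AddMonoidAlgebra.coeff_smul_apply, smul_eq_mul] at h
    rw [← h0] at h ⊢
    simpa using h
  obtain ⟨r, hr, m, rfl, hrC⟩ := hC N hpos
  refine (coeff_coinProd_le_of_eq_add a (t • δ) r m hr).trans ?_
  refine mul_le_mul_of_nonneg_right ?_ hpos.le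
  have h1 := prod_cosh_pow_le (t • δ) r
  have h2 := prod_cosh_pow_le (fun k => 2 * (t • δ) k) m
  have hr' : 0 < (coinProd a 0 r).coeff 0 := hr
  simp only [mul_pow (2 : ℝ), Finset.prod_mul_distrib]
  calc _ = (∏ k, (2 : ℝ) ^ r k) / (coinProd a 0 r).coeff 0 *
        ((∏ k, Real.cosh ((t • δ) k) ^ r k) * ∏ k, Real.cosh (2 * (t • δ) k) ^ m k) := by ring
    _ ≤ (∏ k, (2 : ℝ) ^ r k) / (coinProd a 0 r).coeff 0 *
        (Real.exp (∑ k, r k * (t • δ) k ^ 2 / 2) *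
          Real.exp (∑ k, m k * (2 * (t • δ) k) ^ 2 / 2)) := by
      refine mul_le_mul_of_nonneg_left (mul_le_mul h1 h2 ?_ (Real.exp_pos _).le) (by positivity)
      exact Finset.prod_nonneg fun k _ => pow_nonneg (by positivity) _
    _ ≤ C * Real.exp (t ^ 2 * (∑ k, δ k ^ 2) * ∑ k, (((r + (m + m)) k : ℕ) : ℝ)) := by
      rw [← Real.exp_add]
      refine mul_le_mul hrC (Real.exp_le_exp.mpr ?_) (Real.exp_pos _).le
        (le_trans (by positivity) hrC)
      rw [← Finset.sum_add_distrib, Finset.mul_sum]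
      refine Finset.sum_le_sum fun k _ => ?_
      have hδ : δ k ^ 2 ≤ ∑ k, δ k ^ 2 :=
        Finset.single_le_sum (f := fun k => δ k ^ 2) (fun _ _ => sq_nonneg _) (Finset.mem_univ k)
      simp only [Pi.smul_apply, smul_eq_mul, Pi.add_apply, Nat.cast_add]
      calc _ ≤ t ^ 2 * δ k ^ 2 * (r k + (m k + m k)) := by
            have : 0 ≤ t ^ 2 * δ k ^ 2 * (r k : ℝ) := by positivity
            nlinarith
        _ ≤ _ := by gcongr

end CoinProduct

section Walk

variable {V K : Type*} [AddCommGroup V] [Fintype K] {l : ℕ}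

theorem coeff_prod_coin [DecidableEq V] (v : Fin l → V) (s : Fin l → ℝ) :
    (∏ j, coin (v j) (s j)).coeff 0 = ∑ ε : Fin l → Bool,
      if ∑ j, cond (ε j) (v j) (-v j) = 0
      then Real.exp (∑ j, cond (ε j) (s j) (-s j)) else 0 := by
  have h (j : Fin l) : coin (v j) (s j) = ∑ b : Bool,
      AddMonoidAlgebra.single (cond b (v j) (-v j)) (Real.exp (cond b (s j) (-s j))) := by
    simp [coin]
  simp only [h, Finset.prod_univ_sum, Fintype.piFinset_univ, AddMonoidAlgebra.prod_single,
    AddMonoidAlgebra.coeff_sum, Finsupp.finsetSum_apply, AddMonoidAlgebra.coeff_single,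
    Finsupp.single_apply, Real.exp_sum]

theorem prod_coin_eq_coinProd (a : K → V) (s : K → ℝ) (p : Fin l → K) :
    ∏ j, coin (a (p j)) (s (p j)) = coinProd a s fun k => #{j | p j = k} := by
  rw [coinProd, ← Finset.prod_fiberwise univ p]
  refine Finset.prod_congr rfl fun k _ => ?_
  rw [Finset.prod_congr rfl (g := fun _ => coin (a k) (s k)), Finset.prod_const]
  intro j hj
  rw [(Finset.mem_filter.mp hj).2]

/-- Exponential moments of random signs conditioned on a vanishing vector sum are Gaussian up to a
constant, uniformly in the number of signs. -/
theorem exists_sum_signs_le [DecidableEq V] (a : K → V) (δ : K → ℝ) :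
    ∃ C : ℝ, ∀ (l : ℕ) (p : Fin l → K) (t : ℝ),
      (∑ ε : Fin l → Bool, if ∑ j, cond (ε j) (a (p j)) (-a (p j)) = 0
        then Real.exp (∑ j, cond (ε j) (t * δ (p j)) (-(t * δ (p j)))) else 0) ≤
      C * Real.exp (t ^ 2 * (∑ k, δ k ^ 2) * l) *
        ∑ ε : Fin l → Bool, if ∑ j, cond (ε j) (a (p j)) (-a (p j)) = 0 then 1 else 0 := by
  obtain ⟨C, hC⟩ := exists_coeff_coinProd_le a δ
  refine ⟨C, fun l p t => ?_⟩
  have hcard : ∑ k, #{j | p j = k} = l :=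
    (Finset.card_eq_sum_card_fiberwise (f := p) (s := univ) (t := univ) (by simp)).symm.trans
      (by simp)
  have h := hC (fun k => #{j | p j = k}) t
  rw [← prod_coin_eq_coinProd a (t • δ) p, ← prod_coin_eq_coinProd a 0 p, coeff_prod_coin,
    coeff_prod_coin, ← Nat.cast_sum, hcard] at h
  simpa using h

end Walk

section ExponentialMoments

theorem cosh_mul_le {s : ℝ} (hs : |s| ≤ 1) (x : ℝ) :
    Real.cosh (s * x) ≤ 1 + s ^ 2 * (Real.cosh x - 1) := by
  have h1 := (hasSum_nat_add_iff' 1).mpr (Real.hasSum_cosh (s * x))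
  have h2 := ((hasSum_nat_add_iff' 1).mpr (Real.hasSum_cosh x)).mul_left (s ^ 2)
  have h := hasSum_le (fun n => ?_) h1 h2
  · simp at h
    linarith
  have hs2 : s ^ 2 ≤ 1 := by rwa [sq_le_one_iff_abs_le_one]
  have hx : 0 ≤ x ^ (2 * (n + 1)) := by rw [pow_mul]; positivity
  have hpow : s ^ (2 * (n + 1)) ≤ s ^ 2 := by
    rw [pow_mul]
    exact pow_le_of_le_one (sq_nonneg s) hs2 n.succ_ne_zero
  rw [mul_pow, ← mul_div_assoc]
  gcongr

/-- For a symmetric finite exponential sum, a multiplicative constant in front of a Gaussian bound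
can be absorbed into the exponent. -/
theorem exp_sum_le_of_symm {ι : Type*} [Fintype ι] {w D : ι → ℝ} (hw : ∀ i, 0 ≤ w i)
    (hsymm : ∀ s, ∑ i, w i * Real.exp (-s * D i) = ∑ i, w i * Real.exp (s * D i))
    {C E : ℝ} (hC : 1 ≤ C) (hE : 0 ≤ E)
    (hle : ∀ s, ∑ i, w i * Real.exp (s * D i) ≤ C * Real.exp (s ^ 2 * E) * ∑ i, w i) (s : ℝ) :
    ∑ i, w i * Real.exp (s * D i) ≤ Real.exp ((C * Real.exp E + E) * s ^ 2) * ∑ i, w i := by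
  have hW : 0 ≤ ∑ i, w i := Finset.sum_nonneg fun i _ => hw i
  have hCE : C ≤ C * Real.exp E := le_mul_of_one_le_right (by linarith) (Real.one_le_exp hE)
  have hcosh (u : ℝ) : ∑ i, w i * Real.exp (u * D i) = ∑ i, w i * Real.cosh (u * D i) := by
    have h : ∑ i, w i * Real.cosh (u * D i) =
        (∑ i, w i * Real.exp (u * D i) + ∑ i, w i * Real.exp (-u * D i)) / 2 := by
      rw [← Finset.sum_add_distrib, Finset.sum_div]
      refine Finset.sum_congr rfl fun i _ => ?_
      rw [Real.cosh_eq, neg_mul]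
      ring
    rw [h, hsymm]
    ring
  rcases le_total |s| 1 with hs | hs
  · have h1 := hle 1
    rw [hcosh] at h1 ⊢
    simp only [one_mul, one_pow] at h1
    calc _ ≤ ∑ i, w i * (1 + s ^ 2 * (Real.cosh (D i) - 1)) := by
          gcongr with i
          exacts [hw i, cosh_mul_le hs _]
      _ = ∑ i, w i + s ^ 2 * (∑ i, w i * Real.cosh (D i) - ∑ i, w i) := by
          rw [← Finset.sum_sub_distrib, Finset.mul_sum, ← Finset.sum_add_distrib]
          exact Finset.sum_congr rfl fun i _ => by ring
      _ ≤ ∑ i, w i + s ^ 2 * (C * Real.exp E * ∑ i, w i) := by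
          gcongr
          linarith
      _ = (C * Real.exp E * s ^ 2 + 1) * ∑ i, w i := by ring
      _ ≤ _ := by
          gcongr
          refine (Real.add_one_le_exp _).trans (Real.exp_le_exp.mpr ?_)
          nlinarith [sq_nonneg s]
  · refine (hle s).trans ?_
    gcongr
    have hs2 : 1 ≤ s ^ 2 := by rwa [one_le_sq_iff_one_le_abs]
    have h : C ≤ Real.exp (C * Real.exp E * s ^ 2) := by
      have := Real.add_one_le_exp (C * Real.exp E * s ^ 2)
      nlinarith
    calc C * Real.exp (s ^ 2 * E) ≤ Real.exp (C * Real.exp E * s ^ 2) * Real.exp (s ^ 2 * E) := by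
          gcongr
      _ = _ := by rw [← Real.exp_add]; ring_nf

/-- Jensen's inequality: centering is dominated by symmetrization with an independent copy. -/
theorem sum_exp_centered_mul_le {ι : Type*} [Fintype ι] {W h : ι → ℝ} (hW : ∀ i, 0 ≤ W i)
    (hpos : 0 < ∑ i, W i) (g : ℝ) :
    (∑ i, W i * Real.exp (g * (h i - (∑ j, W j * h j) / ∑ j, W j))) * ∑ j, W j ≤
      ∑ i, ∑ j, W i * W j * Real.exp (g * (h i - h j)) := by
  set m := (∑ j, W j * h j) / ∑ j, W j with hm
  have hmean : ∑ j, W j * (g * (m - h j) + 1) = ∑ j, W j := by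
    have hZ : m * ∑ j, W j = ∑ j, W j * h j := div_mul_cancel₀ _ hpos.ne'
    calc _ = g * (m * ∑ j, W j - ∑ j, W j * h j) + ∑ j, W j := by
          rw [Finset.mul_sum, ← Finset.sum_sub_distrib, Finset.mul_sum, ← Finset.sum_add_distrib]
          exact Finset.sum_congr rfl fun j _ => by ring
      _ = _ := by rw [hZ]; ring
  rw [Finset.sum_mul]
  refine Finset.sum_le_sum fun i _ => ?_
  calc _ = ∑ j, W i * Real.exp (g * (h i - m)) * (W j * (g * (m - h j) + 1)) := by
        rw [← Finset.mul_sum, hmean]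
    _ ≤ ∑ j, W i * Real.exp (g * (h i - m)) * (W j * Real.exp (g * (m - h j))) := by
        gcongr with j
        exacts [mul_nonneg (hW i) (Real.exp_pos _).le, hW j, Real.add_one_le_exp _]
    _ = _ := by
        refine Finset.sum_congr rfl fun j _ => ?_
        rw [show g * (h i - h j) = g * (h i - m) + g * (m - h j) by ring, Real.exp_add]
        ring

end ExponentialMoments

section Swap

variable {Ω : Type} {d l : ℕ}

/-- Exchange the two members of the `j`-th pair whenever `ε j` is false. -/
def swapPairs (ε : Fin l → Bool) (p : Fin l → Ω × Ω) (j : Fin l) : Ω × Ω :=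
  cond (ε j) (p j) (p j).swap

theorem swapPairs_involutive (ε : Fin l → Bool) :
    Function.Involutive (swapPairs (Ω := Ω) ε) := by
  intro p
  funext j
  cases h : ε j <;> simp [swapPairs, h]

theorem zAvg_eq_smul (ζ : Ω → Fin d → ℝ) (σ : Fin l → Ω) :
    zAvg ζ σ = (l : ℝ)⁻¹ • ∑ j, ζ (σ j) := by
  funext i
  simp [zAvg]

theorem zAvg_pair_eq_iff (hl : 0 < l) (ζ : Ω → Fin d → ℝ) (x : Fin d → ℝ) (p : Fin l → Ω × Ω) :
    zAvg ζ (fun j => (p j).1) = x ∧ zAvg ζ (fun j => (p j).2) = x ↔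
      (l : ℝ)⁻¹ • ∑ j, (ζ (p j).1 + ζ (p j).2) = (2 : ℝ) • x ∧
        ∑ j, (ζ (p j).1 - ζ (p j).2) = 0 := by
  have hl' : (l : ℝ)⁻¹ ≠ 0 := by positivity
  rw [zAvg_eq_smul, zAvg_eq_smul, Finset.sum_add_distrib, Finset.sum_sub_distrib, smul_add,
    sub_eq_zero, two_smul]
  constructor
  · rintro ⟨h1, h2⟩
    exact ⟨by rw [h1, h2], smul_right_injective _ hl' (h1.trans h2.symm)⟩
  · rintro ⟨h1, h2⟩
    rw [← h2, ← two_smul ℝ, ← two_smul ℝ x] at h1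
    have h := smul_right_injective _ (two_ne_zero' ℝ) h1
    exact ⟨h, h2 ▸ h⟩

variable [Fintype Ω]

/-- Joint weight of a pair of blocks restricted to both averages being `x`, tilted by the
difference of the sums of `ξ`. -/
noncomputable def pairWeight (π : Ω → ℝ) (ζ : Ω → Fin d → ℝ) (ξ : Ω → ℝ) (x : Fin d → ℝ) (t : ℝ)
    (p : Fin l → Ω × Ω) : ℝ :=
  (if zAvg ζ (fun j => (p j).1) = x then wt π (fun j => (p j).1) else 0) *
    (if zAvg ζ (fun j => (p j).2) = x then wt π (fun j => (p j).2) else 0) *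
    Real.exp (t * ∑ j, (ξ (p j).1 - ξ (p j).2))

theorem pairWeight_swapPairs (hl : 0 < l) (π : Ω → ℝ) (ζ : Ω → Fin d → ℝ) (ξ : Ω → ℝ)
    (x : Fin d → ℝ) (t : ℝ) (p : Fin l → Ω × Ω) (ε : Fin l → Bool) :
    pairWeight π ζ ξ x t (swapPairs ε p) =
      (if (l : ℝ)⁻¹ • ∑ j, (ζ (p j).1 + ζ (p j).2) = (2 : ℝ) • x
        then ∏ j, π (p j).1 * π (p j).2 else 0) *
      if ∑ j, cond (ε j) (ζ (p j).1 - ζ (p j).2) (-(ζ (p j).1 - ζ (p j).2)) = 0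
        then Real.exp (∑ j, cond (ε j) (t * (ξ (p j).1 - ξ (p j).2))
          (-(t * (ξ (p j).1 - ξ (p j).2)))) else 0 := by
  have hsum : ∑ j, (ζ (swapPairs ε p j).1 + ζ (swapPairs ε p j).2) =
      ∑ j, (ζ (p j).1 + ζ (p j).2) := Finset.sum_congr rfl fun j _ => by
    cases h : ε j <;> simp [swapPairs, h, add_comm]
  have hdiff : ∑ j, (ζ (swapPairs ε p j).1 - ζ (swapPairs ε p j).2) =
      ∑ j, cond (ε j) (ζ (p j).1 - ζ (p j).2) (-(ζ (p j).1 - ζ (p j).2)) :=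
    Finset.sum_congr rfl fun j _ => by cases h : ε j <;> simp [swapPairs, h]
  have hexp : t * ∑ j, (ξ (swapPairs ε p j).1 - ξ (swapPairs ε p j).2) =
      ∑ j, cond (ε j) (t * (ξ (p j).1 - ξ (p j).2)) (-(t * (ξ (p j).1 - ξ (p j).2))) := by
    rw [Finset.mul_sum]
    refine Finset.sum_congr rfl fun j _ => ?_
    cases h : ε j <;> simp [swapPairs, h, ← mul_neg]
  have hwt : wt π (fun j => (swapPairs ε p j).1) * wt π (fun j => (swapPairs ε p j).2) =
      ∏ j, π (p j).1 * π (p j).2 := by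
    rw [wt, wt, ← Finset.prod_mul_distrib]
    refine Finset.prod_congr rfl fun j _ => ?_
    cases h : ε j <;> simp [swapPairs, h, mul_comm]
  rw [pairWeight, ite_zero_mul_ite_zero, hwt, hexp, ite_zero_mul, ← mul_ite_zero,
    if_congr (zAvg_pair_eq_iff hl ζ x _) rfl rfl, hsum, hdiff]
  split_ifs <;> simp_all

theorem sum_pairWeight_swapPairs (π : Ω → ℝ) (ζ : Ω → Fin d → ℝ) (ξ : Ω → ℝ) (x : Fin d → ℝ)
    (t : ℝ) : 2 ^ l * ∑ p : Fin l → Ω × Ω, pairWeight π ζ ξ x t p =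
      ∑ p : Fin l → Ω × Ω, ∑ ε : Fin l → Bool, pairWeight π ζ ξ x t (swapPairs ε p) := by
  rw [Finset.sum_comm]
  have h (ε : Fin l → Bool) : ∑ p : Fin l → Ω × Ω, pairWeight π ζ ξ x t (swapPairs ε p) =
      ∑ p : Fin l → Ω × Ω, pairWeight π ζ ξ x t p :=
    Equiv.sum_comp (swapPairs_involutive ε).toPerm _
  simp [h]

theorem exists_sum_pairWeight_le (π : Ω → ℝ) (hπ : ∀ ω, 0 ≤ π ω) (ζ : Ω → Fin d → ℝ)
    (ξ : Ω → ℝ) : ∃ C E : ℝ, 1 ≤ C ∧ 0 ≤ E ∧ ∀ l : ℕ, 0 < l → ∀ (x : Fin d → ℝ) (t : ℝ),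
      ∑ p : Fin l → Ω × Ω, pairWeight π ζ ξ x t p ≤
        C * Real.exp (t ^ 2 * E * l) * ∑ p : Fin l → Ω × Ω, pairWeight π ζ ξ x 0 p := by
  obtain ⟨C, hC⟩ := exists_sum_signs_le (fun k : Ω × Ω => ζ k.1 - ζ k.2) fun k => ξ k.1 - ξ k.2
  refine ⟨max C 1, ∑ k : Ω × Ω, (ξ k.1 - ξ k.2) ^ 2, le_max_right _ _,
    Finset.sum_nonneg fun _ _ => sq_nonneg _, fun l hl x t => ?_⟩
  rw [← mul_le_mul_iff_right₀ (pow_pos two_pos l : (0 : ℝ) < 2 ^ l), mul_left_comm,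
    sum_pairWeight_swapPairs, sum_pairWeight_swapPairs, Finset.mul_sum]
  refine Finset.sum_le_sum fun p _ => ?_
  simp only [pairWeight_swapPairs hl, ← Finset.mul_sum]
  rw [mul_left_comm]
  refine mul_le_mul_of_nonneg_left ?_ ?_
  · refine (hC l p t).trans ?_
    have hcond (b : Bool) : cond b (0 : ℝ) 0 = 0 := by cases b <;> rfl
    simp only [zero_mul, neg_zero, hcond, Finset.sum_const_zero, Real.exp_zero]
    gcongr
    exact le_max_left _ _
  · split_ifs
    exacts [Finset.prod_nonneg fun j _ => mul_nonneg (hπ _) (hπ _), le_rfl]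

end Swap

section Microcanonical

variable {Ω : Type} {d l : ℕ}

theorem zAvg_comp_perm (ζ : Ω → Fin d → ℝ) (σ : Fin l → Ω) (e : Equiv.Perm (Fin l)) :
    zAvg ζ (σ ∘ e) = zAvg ζ σ := by
  funext i
  simp only [zAvg, Function.comp_apply]
  rw [Equiv.sum_comp e fun j => ζ (σ j) i]

theorem wt_comp_perm [Fintype Ω] (π : Ω → ℝ) (σ : Fin l → Ω) (e : Equiv.Perm (Fin l)) :
    wt π (σ ∘ e) = wt π σ :=
  Equiv.prod_comp e fun j => π (σ j)

variable [Fintype Ω]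

/-- Restriction of the product weight to blocks with average `x`. -/
noncomputable def microWt (π : Ω → ℝ) (ζ : Ω → Fin d → ℝ) (x : Fin d → ℝ) (σ : Fin l → Ω) : ℝ :=
  if zAvg ζ σ = x then wt π σ else 0

theorem microWt_nonneg {π : Ω → ℝ} (hπ : ∀ ω, 0 ≤ π ω) (ζ : Ω → Fin d → ℝ) (x : Fin d → ℝ)
    (σ : Fin l → Ω) : 0 ≤ microWt π ζ x σ := by
  rw [microWt]
  split_ifs
  exacts [Finset.prod_nonneg fun _ _ => hπ _, le_rfl]

theorem condExp_eq (π : Ω → ℝ) (ζ : Ω → Fin d → ℝ) (x : Fin d → ℝ) (f : (Fin l → Ω) → ℝ) :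
    condExp π ζ x f = (∑ σ, microWt π ζ x σ * f σ) / ∑ σ : Fin l → Ω, microWt π ζ x σ := by
  simp only [condExp, microWt, ite_mul, zero_mul]

theorem sum_microWt_apply (π : Ω → ℝ) (ζ : Ω → Fin d → ℝ) (ξ : Ω → ℝ) (x : Fin d → ℝ)
    (i j : Fin l) :
    ∑ σ : Fin l → Ω, microWt π ζ x σ * ξ (σ i) = ∑ σ : Fin l → Ω, microWt π ζ x σ * ξ (σ j) := by
  refine Fintype.sum_equiv ((Equiv.swap i j).arrowCongr (Equiv.refl Ω)) _ _ fun σ => ?_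
  have h : (Equiv.swap i j).arrowCongr (Equiv.refl Ω) σ = σ ∘ Equiv.swap i j := by
    funext k
    simp [Equiv.arrowCongr]
  rw [h, microWt, microWt, zAvg_comp_perm, wt_comp_perm]
  simp

/-- By exchangeability, a coordinate and the block average have the same conditional mean. -/
theorem condExp_apply_eq_xAvg (π : Ω → ℝ) (ζ : Ω → Fin d → ℝ) (ξ : Ω → ℝ) (x : Fin d → ℝ)
    (i : Fin l) :
    condExp π ζ x (fun τ : Fin l → Ω => ξ (τ i)) = condExp π ζ x (xAvg (l := l) ξ) := by
  have hl : (l : ℝ) ≠ 0 := Nat.cast_ne_zero.mpr i.pos.ne'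
  rw [condExp_eq, condExp_eq]
  congr 1
  symm
  calc ∑ σ : Fin l → Ω, microWt π ζ x σ * xAvg ξ σ
      = (l : ℝ)⁻¹ * ∑ j : Fin l, ∑ σ : Fin l → Ω, microWt π ζ x σ * ξ (σ j) := by
        rw [Finset.sum_comm, Finset.mul_sum]
        refine Finset.sum_congr rfl fun σ _ => ?_
        rw [xAvg, ← Finset.mul_sum]
        ring
    _ = _ := by
        rw [Finset.sum_congr rfl fun j _ => sum_microWt_apply π ζ ξ x j i]
        simp [hl]

theorem sum_microWt_mul_exp (π : Ω → ℝ) (ζ : Ω → Fin d → ℝ) (ξ : Ω → ℝ) (x : Fin d → ℝ)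
    (s : ℝ) (hl : 0 < l) :
    ∑ q : (Fin l → Ω) × (Fin l → Ω), microWt π ζ x q.1 * microWt π ζ x q.2 *
      Real.exp (s * (√l * (xAvg ξ q.1 - xAvg ξ q.2))) =
    ∑ p : Fin l → Ω × Ω, pairWeight π ζ ξ x (s / √l) p := by
  symm
  refine Fintype.sum_equiv (Equiv.arrowProdEquivProdArrow _ _ _) _ _ fun p => ?_
  rw [pairWeight]
  congr 2
  have h1 : √(l : ℝ) ≠ 0 := by positivity
  have h2 : (l : ℝ) = √l * √l := (Real.mul_self_sqrt l.cast_nonneg).symm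
  simp only [xAvg, Equiv.arrowProdEquivProdArrow, Equiv.coe_fn_mk, ← mul_sub,
    ← Finset.sum_sub_distrib]
  rw [← mul_assoc √(l : ℝ), show √(l : ℝ) * (l : ℝ)⁻¹ = (√(l : ℝ))⁻¹ by
    nth_rewrite 2 [h2]; field_simp]
  ring

end Microcanonical

/-- Uniform conditional sub-Gaussian bound for the microcanonically centered
block average: E[exp{γ√l(ξ̄_l − Ξ_l(x))} | ζ̄_l = x] ≤ exp{Bγ²} with B
independent of l and x, where Ξ_l(x) = E[ξ₁ | ζ̄_l = x]. -/
theorem stmt_17 {Ω : Type} [Fintype Ω] [Nonempty Ω]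
    (π : Ω → ℝ) (hπ0 : ∀ ω, 0 ≤ π ω) (hπ1 : ∑ ω, π ω = 1)
    (d : ℕ) (ζ : Ω → Fin d → ℝ) (ξ : Ω → ℝ) :
    ∃ B : ℝ, ∀ l : ℕ, ∀ hl : 0 < l, ∀ x : Fin d → ℝ,
      (0 < ∑ σ : Fin l → Ω, if zAvg ζ σ = x then wt π σ else 0) →
      ∀ γ : ℝ,
        condExp π ζ x
            (fun σ : Fin l → Ω =>
              Real.exp (γ * Real.sqrt l *
                (xAvg ξ σ - condExp π ζ x (fun τ : Fin l → Ω => ξ (τ ⟨0, hl⟩)))))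
          ≤ Real.exp (B * γ^2) := by
  obtain ⟨C, E, hC, hE, hle⟩ := exists_sum_pairWeight_le π hπ0 ζ ξ
  refine ⟨C * Real.exp E + E, fun l hl x hpos γ => ?_⟩
  change 0 < ∑ σ, microWt π ζ x σ at hpos
  rw [condExp_apply_eq_xAvg, condExp_eq, condExp_eq, div_le_iff₀ hpos,
    ← mul_le_mul_iff_left₀ hpos]
  refine (sum_exp_centered_mul_le (microWt_nonneg hπ0 ζ x) hpos _).trans ?_
  have hmass : ∑ q : (Fin l → Ω) × (Fin l → Ω), microWt π ζ x q.1 * microWt π ζ x q.2 =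
      (∑ σ : Fin l → Ω, microWt π ζ x σ) * ∑ σ : Fin l → Ω, microWt π ζ x σ := by
    rw [Fintype.sum_prod_type, Finset.sum_mul_sum]
  have h := exp_sum_le_of_symm
    (w := fun q : (Fin l → Ω) × (Fin l → Ω) => microWt π ζ x q.1 * microWt π ζ x q.2)
    (D := fun q => √l * (xAvg ξ q.1 - xAvg ξ q.2))
    (fun q => mul_nonneg (microWt_nonneg hπ0 ζ x _) (microWt_nonneg hπ0 ζ x _))
    (fun s => Fintype.sum_equiv (Equiv.prodComm _ _) _ _ fun q => by
      simp only [Equiv.prodComm_apply, Prod.fst_swap, Prod.snd_swap]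
      rw [mul_comm (microWt π ζ x q.1)]
      congr 2
      ring) hC hE (fun s => ?_) γ
  · rw [hmass, Fintype.sum_prod_type] at h
    rw [mul_assoc]
    simpa only [mul_assoc] using h
  · have h0 := sum_microWt_mul_exp π ζ ξ x 0 hl
    simp only [zero_mul, Real.exp_zero, mul_one, zero_div] at h0
    rw [sum_microWt_mul_exp π ζ ξ x s hl, h0]
    convert hle l hl x (s / √l) using 3
    rw [div_pow, Real.sq_sqrt l.cast_nonneg]
    field_simp
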